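/- arXiv:0802.2165 — 3 statements merged into one kernel-verified Lean document; each statement's English description precedes it below -/
import Mathlib

section
/- Let n ≥ 1 be an integer, t = (t_1,…,t_n) real numbers all nonzero, and h, h_i, h_d real numbers. Define the quasi-polynomial Q(σ) = σ e^σ ∏_{i=1}^n (1+t_i σ) + h_i + h σ + h_d σ², and set F(y) = Re Q(iy), G(y) = Im Q(iy) for y ∈ ℝ. Let ε ∈ ℝ satisfy sin(ε + (n+1)π/2) ≠ 0, and assume Q(iy) ≠ 0 for all real y. Then every zero of Q lies in the open left half-plane {σ : Re σ < 0} if and only if both: (a) for every real y₀ with G(y₀) = 0 one has F(y₀)·G'(y₀) > 0; (b) there exists r₀ ∈ ℕ such that for every natural number r ≥ r₀ the set {y ∈ [−2rπ+ε, 2rπ+ε] : G(y) = 0} is finite with exactly 4r + n + 1 elements. -/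
/-- The normalized characteristic quasi-polynomial
`Q(σ) = σ e^σ ∏ᵢ(1 + tᵢσ) + h_i + hσ + h_dσ²` of a PID-controlled time-delay plant
whose transfer function has no zeros. -/
noncomputable def quasiPoly {n : ℕ} (t : Fin n → ℝ) (h hi hd : ℝ) (σ : ℂ) : ℂ :=
  σ * Complex.exp σ * ∏ i, (1 + (t i : ℂ) * σ) +
    ((hi : ℂ) + (h : ℂ) * σ + (hd : ℂ) * σ ^ 2)

section

open Complex MeasureTheory Set Filter Topology

/-- The integral of `f` over the positively oriented boundary of `[a, b] × [c, d]`. -/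
noncomputable def rectIntegral (f : ℂ → ℂ) (a b c d : ℝ) : ℂ :=
  (∫ x in a..b, f (x + c * I)) - (∫ x in a..b, f (x + d * I)) +
    I * (∫ y in c..d, f (b + y * I)) - I * ∫ y in c..d, f (a + y * I)

/-- The boundary of the rectangle `[a, b] × [c, d]`. -/
def rectBoundary (a b c d : ℝ) : Set ℂ :=
  (Icc a b ×ℂ Icc c d) \ (Ioo a b ×ℂ Ioo c d)

section

variable {a b c d : ℝ}

lemma mem_rectBoundary_bottom (hcd : c ≤ d) {x : ℝ} (hx : x ∈ Icc a b) :
    (x + c * I : ℂ) ∈ rectBoundary a b c d := by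
  simp [rectBoundary, mem_reProdIm, hx.1, hx.2, hcd]

lemma mem_rectBoundary_top (hcd : c ≤ d) {x : ℝ} (hx : x ∈ Icc a b) :
    (x + d * I : ℂ) ∈ rectBoundary a b c d := by
  simp [rectBoundary, mem_reProdIm, hx.1, hx.2, hcd]

lemma mem_rectBoundary_left (hab : a ≤ b) {y : ℝ} (hy : y ∈ Icc c d) :
    (a + y * I : ℂ) ∈ rectBoundary a b c d := by
  simp [rectBoundary, mem_reProdIm, hy.1, hy.2, hab]

lemma mem_rectBoundary_right (hab : a ≤ b) {y : ℝ} (hy : y ∈ Icc c d) :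
    (b + y * I : ℂ) ∈ rectBoundary a b c d := by
  simp [rectBoundary, mem_reProdIm, hy.1, hy.2, hab]

lemma intervalIntegrable_edges {f : ℂ → ℂ} (hab : a ≤ b) (hcd : c ≤ d)
    (hf : ContinuousOn f (rectBoundary a b c d)) :
    IntervalIntegrable (fun x : ℝ => f (x + c * I)) volume a b ∧
    IntervalIntegrable (fun x : ℝ => f (x + d * I)) volume a b ∧
    IntervalIntegrable (fun y : ℝ => f (b + y * I)) volume c d ∧
    IntervalIntegrable (fun y : ℝ => f (a + y * I)) volume c d := by
  refine ⟨?_, ?_, ?_, ?_⟩ <;> apply ContinuousOn.intervalIntegrable <;>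
    (first | rw [uIcc_of_le hab] | rw [uIcc_of_le hcd]) <;>
    refine hf.comp (Continuous.continuousOn (by fun_prop)) ?_
  · exact fun x hx => mem_rectBoundary_bottom hcd hx
  · exact fun x hx => mem_rectBoundary_top hcd hx
  · exact fun x hx => mem_rectBoundary_right hab hx
  · exact fun x hx => mem_rectBoundary_left hab hx

lemma rectIntegral_congr {f g : ℂ → ℂ} (hab : a ≤ b) (hcd : c ≤ d)
    (h : EqOn f g (rectBoundary a b c d)) :
    rectIntegral f a b c d = rectIntegral g a b c d := by
  unfold rectIntegral
  congr 1
  · congr 1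
    · congr 1
      · exact intervalIntegral.integral_congr fun x hx =>
          h (mem_rectBoundary_bottom hcd (uIcc_of_le hab ▸ hx))
      · exact intervalIntegral.integral_congr fun x hx =>
          h (mem_rectBoundary_top hcd (uIcc_of_le hab ▸ hx))
    · congr 1
      exact intervalIntegral.integral_congr fun x hx =>
        h (mem_rectBoundary_right hab (uIcc_of_le hcd ▸ hx))
  · congr 1
    exact intervalIntegral.integral_congr fun x hx =>
      h (mem_rectBoundary_left hab (uIcc_of_le hcd ▸ hx))

lemma rectIntegral_const_mul_add {f g : ℂ → ℂ} (hab : a ≤ b) (hcd : c ≤ d) (k : ℂ)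
    (hf : ContinuousOn f (rectBoundary a b c d)) (hg : ContinuousOn g (rectBoundary a b c d)) :
    rectIntegral (fun z => k * f z + g z) a b c d =
      k * rectIntegral f a b c d + rectIntegral g a b c d := by
  obtain ⟨f1, f2, f3, f4⟩ := intervalIntegrable_edges hab hcd hf
  obtain ⟨g1, g2, g3, g4⟩ := intervalIntegrable_edges hab hcd hg
  unfold rectIntegral
  rw [intervalIntegral.integral_add (f1.const_mul k) g1,
    intervalIntegral.integral_add (f2.const_mul k) g2,
    intervalIntegral.integral_add (f3.const_mul k) g3,
    intervalIntegral.integral_add (f4.const_mul k) g4]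
  simp only [intervalIntegral.integral_const_mul]
  ring

lemma rectIntegral_eq_zero {f : ℂ → ℂ} (hab : a ≤ b) (hcd : c ≤ d)
    (hf : DifferentiableOn ℂ f (Icc a b ×ℂ Icc c d)) : rectIntegral f a b c d = 0 := by
  have := integral_boundary_rect_eq_zero_of_differentiableOn f (a + c * I) (b + d * I)
    (by simpa [uIcc_of_le hab, uIcc_of_le hcd] using hf)
  simpa [rectIntegral] using this

lemma integral_horizontal_edge {f F : ℂ → ℂ} (hab : a ≤ b)
    (hF : ∀ x ∈ Icc a b, HasDerivAt F (f (x + c * I)) (x + c * I))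
    (hf : IntervalIntegrable (fun x : ℝ => f (x + c * I)) volume a b) :
    ∫ x in a..b, f (x + c * I) = F (b + c * I) - F (a + c * I) := by
  refine intervalIntegral.integral_eq_sub_of_hasDerivAt (f := fun x : ℝ => F (x + c * I))
    (fun x hx => ?_) hf
  rw [uIcc_of_le hab] at hx
  have h1 : HasDerivAt (fun x : ℂ => F (x + c * I)) (f (x + c * I)) (x : ℂ) :=
    (hF x hx).comp_add_const _ _
  exact h1.comp_ofReal

lemma integral_vertical_edge {f F : ℂ → ℂ} (hcd : c ≤ d)
    (hF : ∀ y ∈ Icc c d, HasDerivAt F (f (a + y * I)) (a + y * I))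
    (hf : IntervalIntegrable (fun y : ℝ => f (a + y * I)) volume c d) :
    I * ∫ y in c..d, f (a + y * I) = F (a + d * I) - F (a + c * I) := by
  rw [← intervalIntegral.integral_const_mul]
  refine intervalIntegral.integral_eq_sub_of_hasDerivAt (f := fun y : ℝ => F (a + y * I))
    (fun y hy => ?_) (hf.const_mul I)
  rw [uIcc_of_le hcd] at hy
  have h0 : HasDerivAt (fun x : ℂ => a + x * I) I (y : ℂ) := by
    simpa using ((hasDerivAt_id (y : ℂ)).mul_const I).const_add (a : ℂ)
  have h1 : HasDerivAt (fun x : ℂ => F (a + x * I)) (f (a + y * I) * I) (y : ℂ) :=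
    (hF y hy).comp (y : ℂ) h0
  simpa [mul_comm] using h1.comp_ofReal

lemma log_neg_of_im_pos {z : ℂ} (hz : 0 < z.im) : log (-z) = log z - Real.pi * I := by
  apply Complex.ext
  · simp [log_re]
  · simp [log_im, arg_neg_eq_arg_sub_pi_of_im_pos hz]

lemma log_neg_of_im_neg {z : ℂ} (hz : z.im < 0) : log (-z) = log z + Real.pi * I := by
  apply Complex.ext
  · simp [log_re]
  · simp [log_im, arg_neg_eq_arg_add_pi_of_im_neg hz]

lemma rectIntegral_inv_sub {w : ℂ} (hw : w ∈ Ioo a b ×ℂ Ioo c d) :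
    rectIntegral (fun z => (z - w)⁻¹) a b c d = 2 * Real.pi * I := by
  obtain ⟨⟨h1, h2⟩, h3, h4⟩ := hw
  have hab : a ≤ b := (h1.trans h2).le
  have hcd : c ≤ d := (h3.trans h4).le
  have hne : ∀ z ∈ rectBoundary a b c d, z - w ≠ 0 := by
    rintro z ⟨-, hz⟩ h
    rw [sub_eq_zero] at h
    exact hz (h ▸ ⟨⟨h1, h2⟩, h3, h4⟩)
  obtain ⟨i1, i2, i3, i4⟩ := intervalIntegrable_edges (f := fun z => (z - w)⁻¹) hab hcd
    (ContinuousOn.inv₀ (by fun_prop) hne)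
  have hlog : ∀ z, z - w ∈ slitPlane → HasDerivAt (fun z => log (z - w)) (z - w)⁻¹ z := by
    intro z hz
    simpa using ((hasDerivAt_id z).sub_const w).clog hz
  have hlog' : ∀ z, w - z ∈ slitPlane → HasDerivAt (fun z => log (w - z)) (z - w)⁻¹ z := by
    intro z hz
    have := ((hasDerivAt_id z).const_sub w).clog hz
    rw [id, ← neg_sub z w, neg_div_neg_eq, one_div] at this
    exact this
  unfold rectIntegral
  rw [integral_horizontal_edge (f := fun z => (z - w)⁻¹) hab (fun x hx => hlog _ (Or.inr ?_)) i1,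
    integral_horizontal_edge (f := fun z => (z - w)⁻¹) hab (fun x hx => hlog _ (Or.inr ?_)) i2,
    integral_vertical_edge (f := fun z => (z - w)⁻¹) hcd (fun x hx => hlog _ (Or.inl ?_)) i3,
    integral_vertical_edge (f := fun z => (z - w)⁻¹) hcd (fun x hx => hlog' _ (Or.inl ?_)) i4]
  · have e1 := log_neg_of_im_pos (z := a + d * I - w) (by simpa using h4)
    have e2 := log_neg_of_im_neg (z := a + c * I - w) (by simpa using h3)
    rw [neg_sub] at e1 e2
    rw [e1, e2]
    ring
  all_goals simp
  all_goals linarith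

lemma exists_eq_pow_mul_of_entire {f : ℂ → ℂ} (hf : Differentiable ℂ f) {w : ℂ}
    (hne : ∃ z, f z ≠ 0) :
    ∃ (k : ℕ) (g : ℂ → ℂ), Differentiable ℂ g ∧ g w ≠ 0 ∧ ∀ z, f z = (z - w) ^ k * g z := by
  obtain ⟨p, hp⟩ := hf.analyticAt w
  have hp0 : p ≠ 0 := by
    rintro rfl
    obtain ⟨z, hz⟩ := hne
    apply hz
    have := AnalyticOnNhd.eq_of_eventuallyEq (f := f) (g := fun _ => 0) (z₀ := w)
      (fun z _ => hf.analyticAt z) (fun z _ => analyticAt_const) (hp.eventually_eq_zero)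
    exact congrFun this z
  have hd : ∀ k : ℕ, Differentiable ℂ ((Function.swap dslope w)^[k] f) := by
    intro k
    induction k with
    | zero => simpa
    | succ k ih =>
      rw [Function.iterate_succ_apply']
      rw [← differentiableOn_univ] at ih ⊢
      exact (differentiableOn_dslope univ_mem).2 ih
  refine ⟨p.order, (Function.swap dslope w)^[p.order] f, hd _,
    hp.iterate_dslope_fslope_ne_zero hp0, fun z => ?_⟩
  simpa using hp.eq_pow_order_mul_iterate_dslope z

lemma finite_zeros_of_entire {f : ℂ → ℂ} (hf : Differentiable ℂ f) (hne : ∃ z, f z ≠ 0)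
    {K : Set ℂ} (hK : IsCompact K) : {z ∈ K | f z = 0}.Finite := by
  obtain ⟨x, hx⟩ := hne
  have h := AnalyticOnNhd.preimage_zero_mem_codiscrete (fun z _ => hf.analyticAt z) hx
  have h' := codiscreteWithin_mono (subset_univ K) h
  refine (hK.finite_sdiff_of_mem_codiscreteWithin h').subset ?_
  rintro z ⟨hz, h0⟩
  exact ⟨hz, by simpa using h0⟩

/-- The argument principle on a rectangle, for an entire function without zeros on the boundary. -/
theorem argument_principle_rect {f : ℂ → ℂ} (hf : Differentiable ℂ f) (hab : a < b) (hcd : c < d)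
    (hbd : ∀ z ∈ rectBoundary a b c d, f z ≠ 0) :
    ∃ N : ℕ, rectIntegral (fun z => deriv f z / f z) a b c d = 2 * Real.pi * I * N ∧
      (N = 0 ↔ ∀ z ∈ Icc a b ×ℂ Icc c d, f z ≠ 0) := by
  have hne : ∀ f : ℂ → ℂ, (∀ z ∈ rectBoundary a b c d, f z ≠ 0) → ∃ z, f z ≠ 0 :=
    fun f h => ⟨_, h _ (mem_rectBoundary_bottom hcd.le (left_mem_Icc.2 hab.le))⟩
  have hK : IsCompact (Icc a b ×ℂ Icc c d) := isCompact_Icc.reProdIm isCompact_Icc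
  have key : ∀ s : Finset ℂ, ∀ f : ℂ → ℂ, Differentiable ℂ f →
      (∀ z ∈ rectBoundary a b c d, f z ≠ 0) → {z ∈ Icc a b ×ℂ Icc c d | f z = 0} = s →
      ∃ N : ℕ, rectIntegral (fun z => deriv f z / f z) a b c d = 2 * Real.pi * I * N ∧
      (N = 0 ↔ s = ∅) := by
    intro s
    induction s using Finset.induction_on with
    | empty =>
      intro f hf hbd hs
      refine ⟨0, ?_, by simp⟩
      rw [rectIntegral_eq_zero hab.le hcd.le]
      · simp
      · refine DifferentiableOn.div hf.deriv.differentiableOn hf.differentiableOn fun z hz h => ?_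
        have : z ∈ {z ∈ Icc a b ×ℂ Icc c d | f z = 0} := ⟨hz, h⟩
        rw [hs] at this
        simp at this
    | insert w s hws ih =>
      intro f hf hbd hs
      have hw : w ∈ Icc a b ×ℂ Icc c d ∧ f w = 0 := by
        have : w ∈ {z ∈ Icc a b ×ℂ Icc c d | f z = 0} := by rw [hs]; simp
        exact this
      have hw' : w ∈ Ioo a b ×ℂ Ioo c d := by
        by_contra h
        exact hbd w ⟨hw.1, h⟩ hw.2
      obtain ⟨k, g, hg, hgw, hfg⟩ := exists_eq_pow_mul_of_entire hf (w := w) (hne f hbd)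
      have hk : k ≠ 0 := by
        rintro rfl
        have := hfg w
        rw [hw.2] at this
        simp at this
        exact hgw this.symm
      have hgbd : ∀ z ∈ rectBoundary a b c d, g z ≠ 0 := fun z hz h => hbd z hz (by simp [hfg, h])
      have hsub : ∀ z ∈ rectBoundary a b c d, z - w ≠ 0 := by
        intro z hz h
        rw [sub_eq_zero] at h
        exact hbd z hz (h ▸ hw.2)
      obtain ⟨N, hN, -⟩ := ih g hg hgbd (by
        ext z
        have hz : z ∈ {z ∈ Icc a b ×ℂ Icc c d | f z = 0} ↔ z ∈ ((insert w s : Finset ℂ) : Set ℂ) := by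
          rw [hs]
        simp only [mem_ofPred_eq, hfg, mul_eq_zero, pow_eq_zero_iff hk, sub_eq_zero,
          Finset.coe_insert, mem_insert_iff] at hz ⊢
        by_cases h : z = w
        · subst h
          simp [hgw, hws]
        · simpa [h] using hz)
      refine ⟨k + N, ?_, by simp [hk]⟩
      rw [rectIntegral_congr (g := fun z => k * (z - w)⁻¹ + deriv g z / g z) hab.le hcd.le,
        rectIntegral_const_mul_add hab.le hcd.le, hN, rectIntegral_inv_sub hw']
      · push_cast
        ring
      · exact ContinuousOn.inv₀ (by fun_prop) hsub
      · exact ContinuousOn.div hg.deriv.continuous.continuousOn hg.continuous.continuousOn hgbd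
      · intro z hz
        have hfg' : f = fun z => (z - w) ^ k * g z := funext hfg
        have hd : HasDerivAt f (k * (z - w) ^ (k - 1) * g z + (z - w) ^ k * deriv g z) z := by
          rw [hfg']
          have := (((hasDerivAt_id z).sub_const w).pow k).mul (hg z).hasDerivAt
          simp only [id, mul_one, Pi.pow_apply] at this
          exact this
        have h1 := hsub z hz
        have h2 := hgbd z hz
        simp only [hd.deriv]
        rw [hfg]
        obtain ⟨m, rfl⟩ := Nat.exists_eq_succ_of_ne_zero hk
        simp only [Nat.succ_eq_add_one, Nat.add_sub_cancel]
        field_simp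
        ring
  have hfin := finite_zeros_of_entire hf (hne f hbd) hK
  obtain ⟨N, hN, h0⟩ := key hfin.toFinset f hf hbd (by simp)
  refine ⟨N, hN, h0.trans ?_⟩
  rw [Set.Finite.toFinset_eq_empty, Set.eq_empty_iff_forall_notMem]
  simp
end

lemma lt_of_pos_deriv_at_level {φ φ' : ℝ → ℝ} {a b k : ℝ}
    (hφ : ∀ y ∈ Icc a b, HasDerivAt φ (φ' y) y)
    (hpos : ∀ y ∈ Icc a b, φ y = k → 0 < φ' y) (hab : a < b) (ha : k ≤ φ a) : k < φ b := by
  have hge : ∀ y ∈ Icc a b, k ≤ φ y := by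
    intro y hy
    have := image_le_of_deriv_right_lt_deriv_boundary' (f := fun _ => k) (f' := fun _ => 0)
      (B := φ) (B' := φ') (a := a) (b := b) continuousOn_const
      (fun x _ => hasDerivWithinAt_const _ _ _) ha
      (fun x hx => (hφ x hx).continuousAt.continuousWithinAt)
      (fun x hx => (hφ x (Ico_subset_Icc_self hx)).hasDerivWithinAt)
      (fun x hx h => hpos x (Ico_subset_Icc_self hx) h.symm)
    exact this hy
  have hb : b ∈ Icc a b := right_mem_Icc.2 hab.le
  refine lt_of_le_of_ne (hge b hb) fun h => ?_
  have hlt : ∀ᶠ y in 𝓝[<] b, φ y < φ b := by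
    have h1 := (hφ b hb).tendsto_slope.mono_left (nhdsWithin_mono b fun y (hy : y < b) => hy.ne)
    filter_upwards [h1.eventually (lt_mem_nhds (hpos b hb h.symm)), self_mem_nhdsWithin] with y hy hyb
    rw [slope_def_field] at hy
    have h2 : y - b < 0 := sub_neg.2 hyb
    have := (div_pos_iff.1 hy).resolve_left (fun h => absurd h.2 (not_lt.2 h2.le))
    linarith [this.1]
  have hmem : ∀ᶠ y in 𝓝[<] b, y ∈ Icc a b := by
    filter_upwards [Ioo_mem_nhdsLT hab] with y hy using Ioo_subset_Icc_self hy
  obtain ⟨y, hy1, hy2⟩ := (hlt.and hmem).exists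
  linarith [hge y hy2]

/-- A function that strictly increases through each integer level takes integer values as often as
its endpoint values predict. -/
lemma ncard_integer_levels {φ φ' : ℝ → ℝ} {a b : ℝ} (hab : a ≤ b)
    (hφ : ∀ y ∈ Icc a b, HasDerivAt φ (φ' y) y)
    (hpos : ∀ y ∈ Icc a b, (∃ k : ℤ, φ y = k) → 0 < φ' y) (ha : ∀ k : ℤ, φ a ≠ k) :
    {y | y ∈ Icc a b ∧ ∃ k : ℤ, φ y = k}.Finite ∧
      {y | y ∈ Icc a b ∧ ∃ k : ℤ, φ y = k}.ncard = (⌊φ b⌋ - ⌊φ a⌋).toNat := by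
  set S := {y | y ∈ Icc a b ∧ ∃ k : ℤ, φ y = k}
  have hlt : ∀ y ∈ Icc a b, ∀ z ∈ Icc a b, y < z → ∀ k : ℤ, (k : ℝ) ≤ φ y → k < φ z := by
    intro y hy z hz hyz k hk
    have hsub : Icc y z ⊆ Icc a b := Icc_subset_Icc hy.1 hz.2
    exact lt_of_pos_deriv_at_level (fun x hx => hφ x (hsub hx))
      (fun x hx h => hpos x (hsub hx) ⟨k, h⟩) hyz hk
  have hinj : InjOn (fun y => ⌊φ y⌋) S := by
    rintro y ⟨hy, k, hk⟩ z ⟨hz, l, hl⟩ h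
    simp only [hk, hl, Int.floor_intCast] at h
    subst h
    rcases lt_trichotomy y z with h | h | h
    · exact absurd hl (hlt y hy z hz h k hk.ge).ne'
    · exact h
    · exact absurd hk (hlt z hz y hy h k hl.ge).ne'
  have himg : (fun y => ⌊φ y⌋) '' S = Finset.Ioc ⌊φ a⌋ ⌊φ b⌋ := by
    ext k
    simp only [mem_image, Finset.coe_Ioc, mem_Ioc]
    constructor
    · rintro ⟨y, ⟨hy, l, hl⟩, rfl⟩
      rw [hl, Int.floor_intCast, Int.floor_lt, Int.le_floor]
      constructor
      · rcases hy.1.eq_or_lt with h | h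
        · exact absurd (h ▸ hl) (ha l)
        · by_contra! h'
          exact absurd hl (hlt a (left_mem_Icc.2 hab) y hy h l h').ne'
      · rcases hy.2.eq_or_lt with h | h
        · exact (h ▸ hl).ge
        · exact (hlt y hy b (right_mem_Icc.2 hab) h l hl.ge).le
    · rintro ⟨h1, h2⟩
      rw [Int.floor_lt] at h1
      rw [Int.le_floor] at h2
      obtain ⟨y, hy, hyk⟩ := intermediate_value_Icc hab
        (fun x hx => (hφ x hx).continuousAt.continuousWithinAt) ⟨h1.le, h2⟩
      exact ⟨y, ⟨hy, k, hyk⟩, by simp [hyk]⟩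
  constructor
  · exact Finite.of_finite_image (himg ▸ Finset.finite_toSet _) hinj
  · rw [← hinj.ncard_image, himg, ncard_coe_finset, Int.card_Ioc]

/-- `Q σ = T σ ^ m (e ^ σ A(1/σ) + B(1/σ))` away from the origin, with `A 0 = 1` and `B 0 = β`. -/
structure DelayAsymptotics (Q A B : ℂ → ℂ) (T β : ℝ) (m : ℕ) : Prop where
  differentiable : Differentiable ℂ Q
  differentiable_left : Differentiable ℂ A
  differentiable_right : Differentiable ℂ B
  leading_ne_zero : T ≠ 0
  left_zero : A 0 = 1
  right_zero : B 0 = β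
  eq_mul : ∀ σ ≠ 0, Q σ = T * σ ^ m * (exp σ * A σ⁻¹ + B σ⁻¹)

/-- The quotient of `Q σ` by `T σ ^ m e ^ σ` in the situation of `DelayAsymptotics`. -/
noncomputable def delayFactor (A B : ℂ → ℂ) (σ : ℂ) : ℂ := A σ⁻¹ + B σ⁻¹ * exp (-σ)

/-- Points of the closed right half-plane far to the right, or at height `±2rπ + ε` with `r ≥ r₀`. -/
def farEdge (ε X₀ : ℝ) (r₀ : ℕ) : Set ℂ :=
  {σ | 0 ≤ σ.re ∧ (X₀ ≤ σ.re ∨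
    ∃ r : ℕ, r₀ ≤ r ∧ (σ.im = 2 * r * Real.pi + ε ∨ σ.im = -(2 * r * Real.pi) + ε))}

lemma exp_neg_of_im {ε : ℝ} {r : ℕ} {σ : ℂ}
    (h : σ.im = 2 * r * Real.pi + ε ∨ σ.im = -(2 * r * Real.pi) + ε) :
    exp (-σ) = (Real.exp (-σ.re) : ℝ) * exp (-(ε * I)) := by
  rw [ofReal_exp, ← exp_add, exp_eq_exp_iff_exists_int]
  rcases h with h | h
  · refine ⟨-r, ?_⟩
    apply Complex.ext <;> simp [h]
    ring
  · refine ⟨r, ?_⟩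
    apply Complex.ext <;> simp [h]
    ring

lemma one_add_mul_exp_mem_slitPlane {ε β s : ℝ} (hβ : β ≠ 0 → Real.sin ε ≠ 0) :
    1 + β * (s * exp (-(ε * I))) ∈ slitPlane := by
  have him : (1 + β * (s * exp (-(ε * I))) : ℂ).im = -(β * s * Real.sin ε) := by
    rw [← neg_mul, ← ofReal_neg, exp_mul_I]
    simp [← ofReal_cos, ← ofReal_sin]
    ring
  by_cases h0 : β * s = 0
  · have : (1 + β * (s * exp (-(ε * I))) : ℂ) = 1 := by
      rw [← mul_assoc, ← ofReal_mul, h0]; simp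
    rw [this]
    exact one_mem_slitPlane
  · right
    rw [him]
    exact neg_ne_zero.2 (mul_ne_zero h0 (hβ (left_ne_zero_of_mul h0)))

namespace DelayAsymptotics

variable {Q A B : ℂ → ℂ} {T β ε : ℝ} {m : ℕ}

lemma eq_mul_delayFactor (H : DelayAsymptotics Q A B T β m) {σ : ℂ} (hσ : σ ≠ 0) :
    Q σ = T * σ ^ m * exp σ * delayFactor A B σ := by
  rw [H.eq_mul σ hσ, delayFactor, exp_neg]
  field_simp [exp_ne_zero]

lemma exists_farEdge_bounds (H : DelayAsymptotics Q A B T β m) (hβ : β ≠ 0 → Real.sin ε ≠ 0) :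
    ∃ η > 0, ∃ X₀ > 0, ∃ r₀ : ℕ, |ε| < 2 * r₀ * Real.pi ∧ ∀ σ ∈ farEdge ε X₀ r₀,
      delayFactor A B σ ∈ slitPlane ∧ η ≤ ‖delayFactor A B σ‖ ∧
        ‖A (-σ⁻¹)‖ + ‖B (-σ⁻¹)‖ ≤ 2 + |β| := by
  set K : Set ℂ := (fun s : ℝ => (1 + β * (s * exp (-(ε * I))) : ℂ)) '' Icc 0 1 ∪
    Metric.closedBall 1 (1 / 2)
  have hK : IsCompact K :=
    (isCompact_Icc.image (by fun_prop)).union (isCompact_closedBall _ _)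
  have hKs : K ⊆ slitPlane := by
    rintro z (⟨s, -, rfl⟩ | hz)
    · exact one_add_mul_exp_mem_slitPlane hβ
    · left
      have h1 := (abs_re_le_norm (z - 1)).trans (mem_closedBall_iff_norm.1 hz)
      have h2 := (abs_le.1 h1).1
      simp only [sub_re, one_re] at h2
      linarith
  obtain ⟨δ, hδ, hδK⟩ := hK.exists_thickening_subset_open isOpen_slitPlane hKs
  have hA : Tendsto A (𝓝 0) (𝓝 1) := H.left_zero ▸ H.differentiable_left.continuous.tendsto 0
  have hB : Tendsto B (𝓝 0) (𝓝 β) := H.right_zero ▸ H.differentiable_right.continuous.tendsto 0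
  have hneg : Tendsto (fun w : ℂ => -w) (𝓝 0) (𝓝 0) := by
    simpa using (continuous_neg (G := ℂ)).tendsto 0
  have h1 : ∀ᶠ w in 𝓝 (0 : ℂ), ‖A w - 1‖ + ‖B w - β‖ < δ / 2 := by
    have : Tendsto (fun w => ‖A w - 1‖ + ‖B w - β‖) (𝓝 0) (𝓝 (‖(1 : ℂ) - 1‖ + ‖(β - β : ℂ)‖)) :=
      (hA.sub_const 1).norm.add (hB.sub_const (β : ℂ)).norm
    refine this.eventually (gt_mem_nhds ?_)
    simpa using hδ
  have h2 : ∀ᶠ w in 𝓝 (0 : ℂ), ‖A (-w)‖ + ‖B (-w)‖ < 2 + |β| := by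
    have : Tendsto (fun w => ‖A (-w)‖ + ‖B (-w)‖) (𝓝 0) (𝓝 (‖(1 : ℂ)‖ + ‖(β : ℂ)‖)) :=
      (hA.comp hneg).norm.add (hB.comp hneg).norm
    refine this.eventually (gt_mem_nhds ?_)
    simp
  obtain ⟨ρ, hρ, hball⟩ := Metric.eventually_nhds_iff.1 (h1.and h2)
  obtain ⟨r₀, hr₀⟩ := exists_nat_gt (1 / ρ + |ε|)
  have hρ' : 0 < 1 / ρ := by positivity
  have hr₀' : ∀ r : ℕ, r₀ ≤ r → 1 / ρ + |ε| < 2 * r * Real.pi := by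
    intro r hr
    have h3 : (r₀ : ℝ) ≤ r := by exact_mod_cast hr
    nlinarith [Real.pi_gt_three, abs_nonneg ε]
  refine ⟨δ / 2, by positivity, 1 / ρ + 1 + 2 * |β|, by positivity, r₀,
    by linarith [hr₀' r₀ le_rfl], ?_⟩
  rintro σ ⟨hre, hσ⟩
  have hbig : 1 / ρ < ‖σ‖ := by
    rcases hσ with h | ⟨r, hr, h⟩
    · have := re_le_norm σ
      linarith [abs_nonneg β]
    · have h3 := hr₀' r hr
      have h4 := abs_im_le_norm σ
      have := neg_abs_le ε
      have := le_abs_self ε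
      rcases h with h | h
      · have := le_abs_self σ.im
        linarith
      · have := neg_abs_le σ.im
        linarith
  have hsmall : dist σ⁻¹ 0 < ρ := by
    rw [dist_zero_right, norm_inv]
    exact inv_lt_of_inv_lt₀ hρ (by simpa using hbig)
  obtain ⟨b1, b2⟩ := hball hsmall
  have hk : 1 + β * exp (-σ) ∈ K := by
    rcases hσ with h | ⟨r, hr, h⟩
    · right
      rw [mem_closedBall_iff_norm, add_sub_cancel_left, norm_mul, norm_exp, neg_re, norm_real,
        Real.norm_eq_abs, Real.exp_neg, ← div_eq_mul_inv, div_le_iff₀ (Real.exp_pos _)]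
      linarith [Real.add_one_le_exp σ.re]
    · left
      refine ⟨Real.exp (-σ.re), ⟨(Real.exp_pos _).le, Real.exp_le_one_iff.2 (by linarith)⟩, ?_⟩
      simp only [exp_neg_of_im h]
  have hdist : dist (delayFactor A B σ) (1 + β * exp (-σ)) < δ / 2 := by
    have he : ‖exp (-σ)‖ ≤ 1 := by
      rw [norm_exp, neg_re]; exact Real.exp_le_one_iff.2 (by linarith)
    calc dist (delayFactor A B σ) (1 + β * exp (-σ))
        = ‖(A σ⁻¹ - 1) + (B σ⁻¹ - β) * exp (-σ)‖ := by
          rw [dist_eq_norm, delayFactor]; congr 1; ring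
      _ ≤ ‖A σ⁻¹ - 1‖ + ‖B σ⁻¹ - β‖ * ‖exp (-σ)‖ := by
          rw [← norm_mul]; exact norm_add_le _ _
      _ ≤ ‖A σ⁻¹ - 1‖ + ‖B σ⁻¹ - β‖ := by
          gcongr; exact mul_le_of_le_one_right (norm_nonneg _) he
      _ < δ / 2 := b1
  refine ⟨hδK ?_, ?_, b2.le⟩
  · exact Metric.mem_thickening_iff.2 ⟨_, hk, hdist.trans (by linarith)⟩
  · by_contra! hlt
    refine zero_notMem_slitPlane (hδK (Metric.mem_thickening_iff.2 ⟨_, hk, ?_⟩))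
    have := dist_triangle 0 (delayFactor A B σ) (1 + β * exp (-σ))
    simp only [dist_zero_left] at this ⊢
    linarith

lemma delayFactor_tendsto (H : DelayAsymptotics Q A B T β m) {y : ℕ → ℝ}
    (hy : ∀ r : ℕ, y r = 2 * r * Real.pi + ε ∨ y r = -(2 * r * Real.pi) + ε) :
    Tendsto (fun r => delayFactor A B (y r * I)) atTop (𝓝 (1 + β * exp (-(ε * I)))) := by
  have h0 : Tendsto (fun r => (y r * I : ℂ)⁻¹) atTop (𝓝 0) := by
    refine tendsto_inv₀_cobounded.comp ?_
    rw [← tendsto_norm_atTop_iff_cobounded]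
    have : Tendsto (fun r : ℕ => 2 * (r : ℝ) * Real.pi - |ε|) atTop atTop := by
      refine tendsto_atTop_add_const_right _ _ ?_
      exact (tendsto_natCast_atTop_atTop.const_mul_atTop two_pos).atTop_mul_const Real.pi_pos
    refine tendsto_atTop_mono (fun r => ?_) this
    simp only [norm_mul, norm_real, norm_I, mul_one, Real.norm_eq_abs]
    have := neg_abs_le ε
    have := le_abs_self ε
    rcases hy r with h | h
    · have := le_abs_self (y r)
      linarith
    · have := neg_abs_le (y r)
      linarith
  have hA : Tendsto A (𝓝 0) (𝓝 1) := H.left_zero ▸ H.differentiable_left.continuous.tendsto 0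
  have hB : Tendsto B (𝓝 0) (𝓝 β) := H.right_zero ▸ H.differentiable_right.continuous.tendsto 0
  refine ((hA.comp h0).add ((hB.comp h0).mul_const (exp (-(ε * I))))).congr fun r => ?_
  have := exp_neg_of_im (ε := ε) (r := r) (σ := y r * I) (by simpa using hy r)
  simp [delayFactor, this]

end DelayAsymptotics

lemma exp_mul_I_mul_im (c : ℝ) (z : ℂ) :
    (exp (c * I) * z).im = ‖z‖ * Real.sin (c + arg z) := by
  conv_lhs => rw [← norm_mul_exp_arg_mul_I z, mul_left_comm, ← exp_add, ← add_mul, ← ofReal_add]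
  rw [im_ofReal_mul, exp_ofReal_mul_I_im]

lemma eventually_add_arg_div_pi_mem_Ioo {c : ℝ} {z : ℂ} (hz : z ∈ slitPlane)
    (h : Real.sin (c + arg z) ≠ 0) :
    ∃ k : ℤ, ∀ᶠ w in 𝓝 z, (c + arg w) / Real.pi ∈ Ioo (k : ℝ) (k + 1) := by
  have hcont : Tendsto (fun w => (c + arg w) / Real.pi) (𝓝 z) (𝓝 ((c + arg z) / Real.pi)) :=
    ((continuousAt_arg hz).const_add c).div_const _
  refine ⟨⌊(c + arg z) / Real.pi⌋, hcont (Ioo_mem_nhds ?_ (Int.lt_floor_add_one _))⟩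
  refine lt_of_le_of_ne (Int.floor_le _) fun h' => h ?_
  rw [eq_div_iff Real.pi_ne_zero] at h'
  rw [← h', Real.sin_int_mul_pi]

namespace DelayAsymptotics

variable {Q A B : ℂ → ℂ} {T β ε : ℝ} {m : ℕ}

/-- A logarithm of `σ ^ m e ^ σ delayFactor A B σ`. -/
noncomputable def logBranch (A B : ℂ → ℂ) (m : ℕ) (z : ℂ) : ℂ :=
  m * log z + z + log (delayFactor A B z)

lemma exp_log_add_logBranch (H : DelayAsymptotics Q A B T β m) {z : ℂ} (hz : z ≠ 0)
    (hu : delayFactor A B z ≠ 0) : exp (log T + logBranch A B m z) = Q z := by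
  rw [H.eq_mul_delayFactor hz, logBranch, exp_add, exp_add, exp_add, exp_nat_mul, exp_log hz,
    exp_log hu, exp_log (ofReal_ne_zero.2 H.leading_ne_zero)]
  ring

lemma hasDerivAt_logBranch (H : DelayAsymptotics Q A B T β m) {z : ℂ} (hz : z ∈ slitPlane)
    (hu : delayFactor A B z ∈ slitPlane) :
    HasDerivAt (logBranch A B m) (deriv Q z / Q z) z := by
  have hz0 := slitPlane_ne_zero hz
  have hdu : DifferentiableAt ℂ (delayFactor A B) z := by
    unfold delayFactor
    have hi : DifferentiableAt ℂ (fun z : ℂ => z⁻¹) z := differentiableAt_inv hz0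
    exact ((H.differentiable_left _).comp z hi).add
      (((H.differentiable_right _).comp z hi).mul (by fun_prop))
  have hd : DifferentiableAt ℂ (logBranch A B m) z := by
    unfold logBranch
    exact (((differentiableAt_log hz).const_mul _).add differentiableAt_id).add (hdu.clog hu)
  have hev : (fun z => exp (log T + logBranch A B m z)) =ᶠ[𝓝 z] Q := by
    filter_upwards [isOpen_ne.mem_nhds hz0,
      hdu.continuousAt.eventually_ne (slitPlane_ne_zero hu)] with w h1 h2
    exact H.exp_log_add_logBranch h1 h2
  have h1 := ((hd.hasDerivAt.const_add (log (T : ℂ))).cexp).congr_of_eventuallyEq hev.symm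
  have h2 : Q z = exp (log T + logBranch A B m z) := hev.self_of_nhds.symm
  have h3 : deriv Q z / Q z = deriv (logBranch A B m) z := by
    rw [h1.deriv, h2, mul_div_cancel_left₀ _ (exp_ne_zero _)]
  rw [h3]
  exact hd.hasDerivAt

/-- On the imaginary axis `Q` has a phase whose increment counts the zeros of `Q` in a rectangle to
the right of the axis. -/
theorem exists_phase (H : DelayAsymptotics Q A B T β m) {c d X : ℝ} (hc : c < 0) (hd : 0 < d)
    (hX : 0 < X)
    (hedge : ∀ z ∈ Icc 0 X ×ℂ Icc c d, z.re = X ∨ z.im = c ∨ z.im = d →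
      delayFactor A B z ∈ slitPlane)
    (hnz : ∀ y : ℝ, Q (y * I) ≠ 0) :
    ∃ N : ℕ, (N = 0 ↔ ∀ z ∈ Icc 0 X ×ℂ Icc c d, Q z ≠ 0) ∧ ∃ φ : ℝ → ℝ,
      (∀ y : ℝ, HasDerivAt φ ((deriv Q (y * I) / Q (y * I)).re / Real.pi) y) ∧
      (∀ y : ℝ, Q (y * I) = ‖Q (y * I)‖ * exp ((Real.pi * φ y : ℝ) * I)) ∧
      Real.pi * φ c = arg T - m * (Real.pi / 2) + c + arg (delayFactor A B (c * I)) ∧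
      Real.pi * φ d = arg T + m * (Real.pi / 2) + d + arg (delayFactor A B (d * I)) -
        2 * Real.pi * N := by
  have hcd := hc.trans hd
  have hslit : ∀ z ∈ Icc 0 X ×ℂ Icc c d, z.re = X ∨ z.im = c ∨ z.im = d → z ∈ slitPlane := by
    rintro z - (h | h | h)
    · exact Or.inl (h ▸ hX)
    · exact Or.inr (h ▸ hc.ne)
    · exact Or.inr (h ▸ hd.ne')
  have hbd : ∀ z ∈ rectBoundary 0 X c d, Q z ≠ 0 := by
    rintro z ⟨hz, hz'⟩
    by_cases h0 : z.re = 0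
    · have : z = z.im * I := by apply Complex.ext <;> simp [h0]
      rw [this]
      exact hnz _
    · have h : z.re = X ∨ z.im = c ∨ z.im = d := by
        by_contra! h
        exact hz' ⟨⟨lt_of_le_of_ne hz.1.1 (Ne.symm h0), lt_of_le_of_ne hz.1.2 h.1⟩,
          lt_of_le_of_ne hz.2.1 (Ne.symm h.2.1), lt_of_le_of_ne hz.2.2 h.2.2⟩
      rw [← H.exp_log_add_logBranch (slitPlane_ne_zero (hslit z hz h))
        (slitPlane_ne_zero (hedge z hz h))]
      exact exp_ne_zero _
  have hder : ∀ z ∈ Icc 0 X ×ℂ Icc c d, z.re = X ∨ z.im = c ∨ z.im = d →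
      HasDerivAt (logBranch A B m) (deriv Q z / Q z) z :=
    fun z hz h => H.hasDerivAt_logBranch (hslit z hz h) (hedge z hz h)
  obtain ⟨N, hN, hN0⟩ := argument_principle_rect H.differentiable hX hcd hbd
  refine ⟨N, hN0, ?_⟩
  obtain ⟨i1, i2, i3, i4⟩ := intervalIntegrable_edges (f := fun z => deriv Q z / Q z) hX.le hcd.le
    (H.differentiable.deriv.continuous.continuousOn.div
      H.differentiable.continuous.continuousOn hbd)
  unfold rectIntegral at hN
  rw [integral_horizontal_edge (f := fun z => deriv Q z / Q z) hX.le (fun x hx => hder _ ?_ ?_) i1,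
    integral_horizontal_edge (f := fun z => deriv Q z / Q z) hX.le (fun x hx => hder _ ?_ ?_) i2,
    integral_vertical_edge (f := fun z => deriv Q z / Q z) hcd.le (fun x hx => hder _ ?_ ?_) i3]
    at hN
  rotate_left
  · exact (mem_rectBoundary_right hX.le hx).1
  · simp
  · exact (mem_rectBoundary_top hcd.le hx).1
  · simp
  · exact (mem_rectBoundary_bottom hcd.le hx).1
  · simp
  set f : ℝ → ℂ := fun y => deriv Q (y * I) / Q (y * I) with hf
  have hfc : Continuous f :=
    (H.differentiable.deriv.continuous.comp (by fun_prop)).div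
      (H.differentiable.continuous.comp (by fun_prop)) hnz
  have hN' : I * ∫ y in c..d, f y =
      logBranch A B m (d * I) - logBranch A B m (c * I) - 2 * Real.pi * I * N := by
    rw [← hN]
    simp only [ofReal_zero, zero_add, hf]
    ring
  have hcu : delayFactor A B (c * I) ∈ slitPlane :=
    hedge _ (by simp [mem_reProdIm, hX.le, hcd.le]) (by simp)
  have hcI : (c * I : ℂ) ≠ 0 := mul_ne_zero (ofReal_ne_zero.2 hc.ne) I_ne_zero
  set L : ℝ → ℂ := fun y => log T + logBranch A B m (c * I) + I * ∫ s in c..y, f s with hL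
  have hLd : ∀ y : ℝ, HasDerivAt L (I * f y) y := fun y =>
    ((intervalIntegral.integral_hasDerivAt_right (hfc.intervalIntegrable _ _)
      (hfc.stronglyMeasurableAtFilter _ _) hfc.continuousAt).const_mul I).const_add _
  have hexp : ∀ y : ℝ, exp (L y) = Q (y * I) := by
    have hQd : ∀ y : ℝ, HasDerivAt (fun y : ℝ => Q (y * I)) (deriv Q (y * I) * I) y := by
      intro y
      have h0 : HasDerivAt (fun x : ℂ => x * I) I (y : ℂ) := by
        simpa using (hasDerivAt_id (y : ℂ)).mul_const I
      exact ((H.differentiable _).hasDerivAt.comp (y : ℂ) h0).comp_ofReal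
    have hquot : ∀ y : ℝ, HasDerivAt (fun y : ℝ => Q (y * I) * exp (-L y)) 0 y := by
      intro y
      refine ((hQd y).mul (hLd y).neg.cexp).congr_deriv ?_
      have := hnz y
      simp only [hf, Pi.neg_apply]
      field_simp
      ring
    have hconst : ∀ y : ℝ, Q (y * I) * exp (-L y) = Q (c * I) * exp (-L c) := fun y =>
      is_const_of_deriv_eq_zero (fun y => (hquot y).differentiableAt) (fun y => (hquot y).deriv) y c
    have hLc : exp (L c) = Q (c * I) := by
      simp only [hL, intervalIntegral.integral_same, mul_zero, add_zero]
      exact H.exp_log_add_logBranch hcI (slitPlane_ne_zero hcu)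
    intro y
    have h1 := hconst y
    rw [← hLc, ← exp_add, add_neg_cancel, exp_zero, exp_neg] at h1
    exact (eq_of_mul_inv_eq_one h1).symm
  have hpi := Real.pi_ne_zero
  refine ⟨fun y => (L y).im / Real.pi, fun y => ?_, fun y => ?_, ?_, ?_⟩
  · have h1 := (imCLM.hasFDerivAt.comp_hasDerivAt y (hLd y)).div_const Real.pi
    simpa [hf] using h1
  · rw [mul_div_cancel₀ _ hpi, ← hexp, norm_exp, ofReal_exp, ← exp_add, re_add_im]
  · rw [mul_div_cancel₀ _ hpi]
    have hlog : (log (c * I)).im = -(Real.pi / 2) := by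
      have : (c * I : ℂ) = ((-c : ℝ) : ℂ) * -I := by push_cast; ring
      rw [log_im, this, arg_real_mul _ (neg_pos.2 hc), arg_neg_I]
    simp only [hL, intervalIntegral.integral_same, mul_zero, add_zero, logBranch]
    simp [hlog, log_im (delayFactor A B (c * I)), log_im (T : ℂ)]
    ring
  · rw [mul_div_cancel₀ _ hpi]
    have hlog : (log (d * I)).im = Real.pi / 2 := by
      rw [log_im, arg_real_mul _ hd, arg_I]
    simp only [hL]
    rw [hN']
    simp [logBranch, hlog, log_im (delayFactor A B (d * I)), log_im (T : ℂ)]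
    ring

end DelayAsymptotics

lemma exists_arg_ofReal_eq (T : ℝ) : ∃ k : ℤ, arg T = k * Real.pi := by
  rcases le_or_gt 0 T with h | h
  · exact ⟨0, by simp [arg_ofReal_of_nonneg h]⟩
  · exact ⟨1, by simp [arg_ofReal_of_neg h]⟩

namespace DelayAsymptotics

variable {Q A B : ℂ → ℂ} {T β ε : ℝ} {m : ℕ}

theorem ncard_im_eq_zero (H : DelayAsymptotics Q A B T β m) (hβ : β ≠ 0 → Real.sin ε ≠ 0)
    (him : (exp ((ε + m * (Real.pi / 2) : ℝ) * I) * (1 + β * exp (-(ε * I)))).im ≠ 0)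
    (hnz : ∀ y : ℝ, Q (y * I) ≠ 0)
    (hpos : ∀ y : ℝ, (Q (y * I)).im = 0 → 0 < (deriv Q (y * I) / Q (y * I)).re) :
    ∃ X₀ : ℝ, ∃ r₀ : ℕ, ∀ X ≥ X₀, ∀ r ≥ r₀, ∃ N : ℕ,
      (N = 0 ↔ ∀ z ∈ Icc 0 X ×ℂ Icc (-(2 * r * Real.pi) + ε) (2 * r * Real.pi + ε), Q z ≠ 0) ∧
      {y : ℝ | y ∈ Icc (-(2 * r * Real.pi) + ε) (2 * r * Real.pi + ε) ∧
        (Q (y * I)).im = 0}.Finite ∧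
      {y : ℝ | y ∈ Icc (-(2 * r * Real.pi) + ε) (2 * r * Real.pi + ε) ∧
        (Q (y * I)).im = 0}.ncard = (4 * r + m - 2 * N : ℤ).toNat := by
  obtain ⟨η, -, X₀, hX₀, r₀, hr₀, hfar⟩ := H.exists_farEdge_bounds hβ
  have hlim : (1 + β * exp (-(ε * I)) : ℂ) ∈ slitPlane := by
    simpa using one_add_mul_exp_mem_slitPlane (s := 1) hβ
  rw [exp_mul_I_mul_im] at him
  obtain ⟨k, hk⟩ := eventually_add_arg_div_pi_mem_Ioo hlim (right_ne_zero_of_mul him)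
  have hkd := (H.delayFactor_tendsto (ε := ε) (y := fun r => 2 * r * Real.pi + ε)
    (fun r => Or.inl rfl)).eventually hk
  have hkc := (H.delayFactor_tendsto (ε := ε) (y := fun r => -(2 * r * Real.pi) + ε)
    (fun r => Or.inr rfl)).eventually hk
  obtain ⟨r₁, hr₁⟩ := eventually_atTop.1 (hkc.and hkd)
  refine ⟨X₀, max r₀ r₁, fun X hX r hr => ?_⟩
  have hrr : r₀ ≤ r := (le_max_left _ _).trans hr
  obtain ⟨hc1, hd1⟩ := hr₁ r ((le_max_right _ _).trans hr)
  set c := -(2 * r * Real.pi) + ε with hc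
  set d := 2 * r * Real.pi + ε with hd
  have hbig : |ε| < 2 * r * Real.pi := by
    have : (r₀ : ℝ) ≤ r := by exact_mod_cast hrr
    nlinarith [Real.pi_pos]
  have hc0 : c < 0 := by linarith [le_abs_self ε]
  have hd0 : 0 < d := by linarith [neg_abs_le ε]
  obtain ⟨N, hN, φ, hφ, hQφ, hφc, hφd⟩ := H.exists_phase hc0 hd0 (hX₀.trans_le hX)
    (fun z hz h => (hfar z ⟨hz.1.1, by
      rcases h with h | h | h
      · exact Or.inl (h ▸ hX)
      · exact Or.inr ⟨r, hrr, Or.inr h⟩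
      · exact Or.inr ⟨r, hrr, Or.inl h⟩⟩).1) hnz
  refine ⟨N, hN, ?_⟩
  have hpi := Real.pi_pos
  have hset : ∀ y : ℝ, (Q (y * I)).im = 0 ↔ ∃ k : ℤ, φ y = k := by
    intro y
    rw [hQφ y, im_ofReal_mul, exp_ofReal_mul_I_im, mul_eq_zero, norm_eq_zero, or_iff_right (hnz y),
      Real.sin_eq_zero_iff]
    refine exists_congr fun k => ⟨fun h => ?_, fun h => ?_⟩
    · rw [mul_comm] at h
      exact (mul_left_cancel₀ hpi.ne' h).symm
    · rw [h, mul_comm]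
  obtain ⟨j, hj⟩ := exists_arg_ofReal_eq T
  set ψ : ℂ → ℝ := fun w => (ε + m * (Real.pi / 2) + arg w) / Real.pi with hψ
  have hφc' : φ c = ψ (delayFactor A B (c * I)) + (j - m - 2 * r : ℤ) := by
    apply mul_left_cancel₀ hpi.ne'
    rw [hφc, hj, hψ, mul_add, mul_div_cancel₀ _ hpi.ne', hc]
    push_cast
    ring
  have hφd' : φ d = ψ (delayFactor A B (d * I)) + (j + 2 * r - 2 * N : ℤ) := by
    apply mul_left_cancel₀ hpi.ne'
    rw [hφd, hj, hψ, mul_add, mul_div_cancel₀ _ hpi.ne', hd]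
    push_cast
    ring
  have hfloor : ∀ x : ℝ, x ∈ Ioo (k : ℝ) (k + 1) → ⌊x⌋ = k := fun x hx =>
    Int.floor_eq_iff.2 ⟨hx.1.le, hx.2⟩
  simp only [hset]
  have hmain := ncard_integer_levels (φ := φ) (hc0.trans hd0).le (fun y _ => hφ y)
    (fun y _ h => div_pos (hpos y ((hset y).2 h)) hpi) (fun l hl => by
      rw [hφc'] at hl
      have h1 : ψ (delayFactor A B (c * I)) = (l - (j - m - 2 * r) : ℤ) := by
        rw [Int.cast_sub, ← hl]; ring
      have h2 := hc1.1
      have h3 := hc1.2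
      change (k : ℝ) < ψ (delayFactor A B (c * I)) at h2
      change ψ (delayFactor A B (c * I)) < k + 1 at h3
      rw [h1] at h2 h3
      norm_cast at h2 h3
      omega)
  refine ⟨hmain.1, hmain.2.trans ?_⟩
  rw [hφc', hφd', Int.floor_add_intCast, Int.floor_add_intCast, hfloor _ hc1, hfloor _ hd1]
  congr 1
  ring

/-- If `Q` has no zeros in the closed right half-plane, then `e ^ σ Q(-σ)` is dominated by `Q σ`
there. -/
theorem norm_exp_mul_le (H : DelayAsymptotics Q A B T β m) (hβ : β ≠ 0 → Real.sin ε ≠ 0)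
    (hconj : ∀ σ, Q (starRingEnd ℂ σ) = starRingEnd ℂ (Q σ))
    (hQ : ∀ σ : ℂ, 0 ≤ σ.re → Q σ ≠ 0) {σ : ℂ} (hσ : 0 ≤ σ.re) :
    ‖exp σ * Q (-σ)‖ ≤ ‖Q σ‖ := by
  set f : ℂ → ℂ := fun σ => exp σ * Q (-σ) / Q σ with hf
  have hdiff : DifferentiableOn ℂ f {z | 0 ≤ z.re} := by
    refine DifferentiableOn.div ?_ H.differentiable.differentiableOn fun z hz => hQ z hz
    exact (differentiable_exp.mul (H.differentiable.comp differentiable_neg)).differentiableOn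
  have himag : ∀ y : ℝ, ‖f (y * I)‖ ≤ 1 := by
    intro y
    have : -(y * I) = starRingEnd ℂ (y * I) := by simp
    simp only [hf]
    rw [norm_div, norm_mul, norm_exp_ofReal_mul_I, one_mul, this, hconj, RCLike.norm_conj]
    exact div_self_le_one _
  obtain ⟨η, hη, X₀, hX₀, r₀, hr₀, hfar⟩ := H.exists_farEdge_bounds hβ
  set M := max 1 ((2 + |β|) / η)
  have hfarM : ∀ z ∈ farEdge ε X₀ r₀, z ≠ 0 → ‖f z‖ ≤ M := by
    intro z hz hz0
    refine le_trans ?_ (le_max_right _ _)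
    obtain ⟨-, h1, h2⟩ := hfar z hz
    have hT : 0 < ‖(T * z ^ m : ℂ)‖ :=
      norm_pos_iff.2 (mul_ne_zero (ofReal_ne_zero.2 H.leading_ne_zero) (pow_ne_zero _ hz0))
    have hnum : ‖exp z * Q (-z)‖ ≤ ‖(T * z ^ m : ℂ)‖ * ‖exp z‖ * (2 + |β|) := by
      have e : exp z * Q (-z) =
          (T * (-z) ^ m) * (A (-z⁻¹) + exp z * B (-z⁻¹)) := by
        rw [H.eq_mul _ (neg_ne_zero.2 hz0), inv_neg, exp_neg]
        field_simp [exp_ne_zero]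
      have hex : 1 ≤ ‖exp z‖ := by
        rw [norm_exp]; exact Real.one_le_exp hz.1
      rw [e, norm_mul, mul_assoc]
      have e2 : ‖(T * (-z) ^ m : ℂ)‖ = ‖(T * z ^ m : ℂ)‖ := by simp
      rw [e2]
      gcongr
      calc ‖A (-z⁻¹) + exp z * B (-z⁻¹)‖ ≤ ‖A (-z⁻¹)‖ + ‖exp z‖ * ‖B (-z⁻¹)‖ := by
            rw [← norm_mul]; exact norm_add_le _ _
        _ ≤ ‖exp z‖ * ‖A (-z⁻¹)‖ + ‖exp z‖ * ‖B (-z⁻¹)‖ := by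
            gcongr
            exact le_mul_of_one_le_left (norm_nonneg _) hex
        _ = ‖exp z‖ * (‖A (-z⁻¹)‖ + ‖B (-z⁻¹)‖) := by ring
        _ ≤ _ := by gcongr
    have hden : ‖(T * z ^ m : ℂ)‖ * ‖exp z‖ * η ≤ ‖Q z‖ := by
      rw [H.eq_mul_delayFactor hz0, norm_mul (T * z ^ m * exp z : ℂ),
        norm_mul (T * z ^ m : ℂ) (exp z)]
      gcongr
    have hp : 0 < ‖(T * z ^ m : ℂ)‖ * ‖exp z‖ := mul_pos hT (norm_pos_iff.2 (exp_ne_zero _))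
    calc ‖f z‖ = ‖exp z * Q (-z)‖ / ‖Q z‖ := norm_div _ _
      _ ≤ (‖(T * z ^ m : ℂ)‖ * ‖exp z‖ * (2 + |β|)) / (‖(T * z ^ m : ℂ)‖ * ‖exp z‖ * η) := by
          gcongr
      _ = (2 + |β|) / η := mul_div_mul_left _ _ hp.ne'
  have hbound : ∀ z : ℂ, 0 < z.re → ‖f z‖ ≤ M := by
    intro z hz
    obtain ⟨r, hr⟩ := exists_nat_gt (max (r₀ : ℝ) (|z.im| + |ε|))
    have hr1 : r₀ ≤ r := by exact_mod_cast ((le_max_left _ _).trans_lt hr).le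
    have hr2 : |z.im| + |ε| < 2 * r * Real.pi := by
      have := (le_max_right (r₀ : ℝ) (|z.im| + |ε|)).trans_lt hr
      nlinarith [Real.pi_gt_three, abs_nonneg z.im, abs_nonneg ε]
    have a1 := le_abs_self z.im
    have a2 := neg_abs_le z.im
    have a3 := le_abs_self ε
    have a4 := neg_abs_le ε
    have a5 := abs_nonneg z.im
    set c := -(2 * r * Real.pi) + ε with hc
    set d := 2 * r * Real.pi + ε with hd
    have hcd : c < d := by linarith
    have hXz : z.re < max X₀ z.re + 1 := by linarith [le_max_right X₀ z.re]
    set X := max X₀ z.re + 1 with hX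
    have hX0 : X₀ ≤ X := by linarith [le_max_left X₀ z.re]
    have hXpos : 0 < X := hX₀.trans_le hX0
    have hcl : closure (Ioo 0 X ×ℂ Ioo c d) = Icc 0 X ×ℂ Icc c d := by
      rw [closure_reProdIm, closure_Ioo hXpos.ne, closure_Ioo hcd.ne]
    refine norm_le_of_forall_mem_frontier_norm_le (U := Ioo 0 X ×ℂ Ioo c d)
      ((Metric.isBounded_Ioo _ _).reProdIm (Metric.isBounded_Ioo _ _)) ?_ ?_
      (subset_closure ⟨⟨hz, hXz⟩, by constructor <;> linarith⟩)
    · apply DifferentiableOn.diffContOnCl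
      rw [hcl]
      exact hdiff.mono fun w hw => hw.1.1
    · intro w hw
      have hw0 : 0 ≤ w.re := by
        have := frontier_subset_closure hw
        rw [hcl] at this
        exact this.1.1
      by_cases hw1 : w.re = 0
      · have : w = w.im * I := by apply Complex.ext <;> simp [hw1]
        rw [this]
        exact (himag _).trans (le_max_left _ _)
      · refine hfarM w ⟨hw0, ?_⟩ (fun h => hw1 (by simp [h]))
        rw [frontier_reProdIm, frontier_Ioo hXpos, frontier_Ioo hcd] at hw
        rcases hw with ⟨-, h | h⟩ | ⟨h | h, -⟩
        · exact Or.inr ⟨r, hr1, Or.inr h⟩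
        · exact Or.inr ⟨r, hr1, Or.inl h⟩
        · exact absurd h hw1
        · exact Or.inl ((show w.re = X from h) ▸ hX0)
  have hle : ‖f σ‖ ≤ 1 := by
    refine PhragmenLindelof.right_half_plane_of_bounded_on_real ?_ ?_ ?_ himag hσ
    · apply DifferentiableOn.diffContOnCl
      rwa [closure_setOfPred_lt_re]
    · refine ⟨1, one_lt_two, 0, Asymptotics.IsBigO.of_bound M ?_⟩
      rw [eventually_inf_principal]
      exact Eventually.of_forall fun z hz => by simpa using hbound z hz
    · refine ⟨M, ?_⟩
      rw [eventually_map]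
      filter_upwards [eventually_gt_atTop 0] with x hx using hbound x (by simpa using hx)
  rwa [hf, norm_div, div_le_one (norm_pos_iff.2 (hQ σ hσ))] at hle

theorem logDeriv_re_pos (H : DelayAsymptotics Q A B T β m) (hβ : β ≠ 0 → Real.sin ε ≠ 0)
    (hconj : ∀ σ, Q (starRingEnd ℂ σ) = starRingEnd ℂ (Q σ))
    (hQ : ∀ σ : ℂ, 0 ≤ σ.re → Q σ ≠ 0) (y : ℝ) :
    0 < (deriv Q (y * I) / Q (y * I)).re := by
  set p : ℝ → ℝ := fun x => ‖Q (x + y * I)‖ ^ 2 with hp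
  set p' := 2 * inner ℝ (Q (y * I)) (deriv Q (y * I)) with hp'
  have hpd : HasDerivAt p p' 0 := by
    have h1 : HasDerivAt (fun x : ℝ => Q (x + y * I)) (deriv Q (y * I)) 0 := by
      have h2 : HasDerivAt (fun x : ℂ => Q (x + y * I)) (deriv Q (y * I)) ((0 : ℝ) : ℂ) := by
        have := ((H.differentiable (((0 : ℝ) : ℂ) + y * I)).hasDerivAt).comp_add_const _ (y * I)
        simpa using this
      exact h2.comp_ofReal
    have h2 := h1.norm_sq
    simp only [ofReal_zero, zero_add] at h2
    exact h2
  have hle : ∀ x : ℝ, 0 ≤ x → Real.exp (2 * x) * p (-x) ≤ p x := by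
    intro x hx
    have h1 := H.norm_exp_mul_le hβ hconj hQ (σ := x + y * I) (by simpa using hx)
    have h2 : -(x + y * I : ℂ) = starRingEnd ℂ ((-x : ℝ) + y * I) := by
      simp; ring
    rw [norm_mul, norm_exp, h2, hconj, RCLike.norm_conj] at h1
    have h3 := pow_le_pow_left₀ (by positivity) h1 2
    rw [mul_pow, ← Real.exp_nat_mul] at h3
    simpa [hp] using h3
  have hpneg : HasDerivAt (fun x => p (-x)) (-p') 0 := by
    have h1 : HasDerivAt p p' (-0) := by simpa using hpd
    have h2 := h1.comp (0 : ℝ) (hasDerivAt_neg (0 : ℝ))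
    rw [mul_neg_one] at h2
    exact h2
  have hexp : HasDerivAt (fun x : ℝ => Real.exp (2 * x)) 2 0 := by
    simpa using ((hasDerivAt_id (0 : ℝ)).const_mul 2).exp
  have hg : HasDerivAt (fun x => p x - Real.exp (2 * x) * p (-x)) (2 * p' - 2 * p 0) 0 := by
    refine (hpd.sub (hexp.mul hpneg)).congr_deriv ?_
    simp
    ring
  have hnn : 0 ≤ 2 * p' - 2 * p 0 := by
    refine ge_of_tendsto (hg.tendsto_slope.mono_left
      (nhdsWithin_mono (0 : ℝ) (s := Ioi 0) fun x (hx : x ∈ Ioi 0) => (ne_of_gt hx))) ?_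
    filter_upwards [self_mem_nhdsWithin] with x (hx : 0 < x)
    rw [slope_def_field]
    have := hle x hx.le
    simp only [neg_zero, mul_zero, Real.exp_zero, one_mul, sub_self, sub_zero]
    exact div_nonneg (by linarith) hx.le
  have hp0 : 0 < p 0 := by
    have : Q (y * I) ≠ 0 := hQ _ (by simp)
    simp only [hp, ofReal_zero, zero_add]
    positivity
  have hinner : 0 < inner ℝ (Q (y * I)) (deriv Q (y * I)) := by linarith
  rw [Complex.inner] at hinner
  have hQ0 : 0 < normSq (Q (y * I)) := normSq_pos.2 (hQ _ (by simp))
  rw [div_re, ← add_div]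
  refine div_pos ?_ hQ0
  simp only [mul_re, conj_re, conj_im] at hinner
  linarith

end DelayAsymptotics

section Plant

variable {n : ℕ} (t : Fin n → ℝ) (h hi hd : ℝ)

lemma quasiPoly_conj (σ : ℂ) : quasiPoly t h hi hd (starRingEnd ℂ σ) =
    starRingEnd ℂ (quasiPoly t h hi hd σ) := by
  simp [quasiPoly, map_prod, exp_conj]

lemma differentiable_quasiPoly : Differentiable ℂ (quasiPoly t h hi hd) := by
  unfold quasiPoly
  fun_prop

lemma quasiPoly_delayAsymptotics (hn : 1 ≤ n) (ht : ∀ i, t i ≠ 0) :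
    DelayAsymptotics (quasiPoly t h hi hd) (fun w => ∏ i, (1 + (t i : ℂ)⁻¹ * w))
      (fun w => (hi * w ^ (n + 1) + h * w ^ n + hd * w ^ (n - 1)) / (∏ i, t i : ℝ))
      (∏ i, t i) (hd * 0 ^ (n - 1) / ∏ i, t i) (n + 1) where
  differentiable := differentiable_quasiPoly t h hi hd
  differentiable_left := by fun_prop
  differentiable_right := by fun_prop
  leading_ne_zero := Finset.prod_ne_zero_iff.2 fun i _ => ht i
  left_zero := by simp
  right_zero := by
    have : n ≠ 0 := by omega
    simp [this]
  eq_mul σ hσ := by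
    have hT : ((∏ i, t i : ℝ) : ℂ) ≠ 0 :=
      ofReal_ne_zero.2 (Finset.prod_ne_zero_iff.2 fun i _ => ht i)
    have hprod : ∏ i, (1 + (t i : ℂ) * σ) =
        (∏ i, t i : ℝ) * σ ^ n * ∏ i, (1 + (t i : ℂ)⁻¹ * σ⁻¹) := by
      have : σ ^ n = ∏ _i : Fin n, σ := by simp
      rw [this, ofReal_prod, ← Finset.prod_mul_distrib, ← Finset.prod_mul_distrib]
      refine Finset.prod_congr rfl fun i _ => ?_
      have := ofReal_ne_zero.2 (ht i)
      field_simp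
      ring
    obtain ⟨k, rfl⟩ := Nat.exists_eq_add_of_le' hn
    have hlow : (∏ i, t i : ℝ) * σ ^ (k + 1 + 1) * ((hi * σ⁻¹ ^ (k + 1 + 1) + h * σ⁻¹ ^ (k + 1) +
        hd * σ⁻¹ ^ (k + 1 - 1)) / (∏ i, t i : ℝ)) = hi + h * σ + hd * σ ^ 2 := by
      generalize ((∏ i, t i : ℝ) : ℂ) = T at hT
      rw [Nat.add_sub_cancel, inv_pow, inv_pow, inv_pow]
      field_simp
      ring
    rw [quasiPoly, hprod, mul_add, hlow]
    ring

end Plant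

lemma hasDerivAt_im_comp_mul_I {Q : ℂ → ℂ} (hQ : Differentiable ℂ Q) (y : ℝ) :
    HasDerivAt (fun y : ℝ => (Q (y * I)).im) (deriv Q (y * I)).re y := by
  have h1 : HasDerivAt (fun y : ℝ => Q (y * I)) (deriv Q (y * I) * I) y := by
    have h2 : HasDerivAt (fun z : ℂ => z * I) I (y : ℂ) := by
      simpa using (hasDerivAt_id (y : ℂ)).mul_const I
    exact ((hQ (y * I)).hasDerivAt.comp (y : ℂ) h2).comp_ofReal
  have h3 := imCLM.hasFDerivAt.comp_hasDerivAt y h1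
  rw [imCLM_apply, mul_I_im] at h3
  exact h3

lemma div_re_pos_iff_of_im_eq_zero {z w : ℂ} (hw : w.im = 0) :
    0 < (z / w).re ↔ 0 < w.re * z.re := by
  have : w = (w.re : ℂ) := by apply Complex.ext <;> simp [hw]
  rw [this, div_ofReal_re, ofReal_re, mul_comm, div_pos_iff, mul_pos_iff]

lemma phase_im_ne_zero {n : ℕ} (hn : 1 ≤ n) (ε a T : ℝ)
    (hε : Real.sin (ε + (n + 1 : ℕ) * Real.pi / 2) ≠ 0) :
    (exp ((ε + (n + 1 : ℕ) * (Real.pi / 2) : ℝ) * I) *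
      (1 + (a * 0 ^ (n - 1) / T : ℝ) * exp (-(ε * I)))).im ≠ 0 := by
  have h1 : (exp ((ε + (n + 1 : ℕ) * (Real.pi / 2) : ℝ) * I)).im =
      Real.sin (ε + (n + 1 : ℕ) * Real.pi / 2) := by
    rw [exp_ofReal_mul_I_im, mul_div_assoc]
  rcases hn.eq_or_lt with rfl | hn'
  · have h2 : exp ((ε + (1 + 1 : ℕ) * (Real.pi / 2) : ℝ) * I) * exp (-(ε * I)) = -1 := by
      rw [← exp_add, ← exp_pi_mul_I]
      congr 1
      push_cast
      ring
    rw [mul_add, mul_one, mul_left_comm, h2, add_im, h1]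
    simpa using hε
  · have : n - 1 ≠ 0 := by omega
    rw [zero_pow this, mul_zero, zero_div, ofReal_zero, zero_mul, add_zero, mul_one, h1]
    exact hε

lemma sin_ne_zero_of_coeff_ne_zero {n : ℕ} (hn : 1 ≤ n) (ε a T : ℝ)
    (hε : Real.sin (ε + (n + 1 : ℕ) * Real.pi / 2) ≠ 0) (h : a * 0 ^ (n - 1) / T ≠ 0) :
    Real.sin ε ≠ 0 := by
  rcases hn.eq_or_lt with rfl | hn'
  · have : ε + (1 + 1 : ℕ) * Real.pi / 2 = ε + Real.pi := by push_cast; ring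
    rw [this, Real.sin_add_pi] at hε
    exact neg_ne_zero.1 hε
  · have : n - 1 ≠ 0 := by omega
    simp [this] at h

end

/-- stability criterion of Section 3, Pontryagin/Hermite–Biehler type.
With `F(y) = Re Q(iy)`, `G(y) = Im Q(iy)`, all zeros of `Q` lie in the open left
half-plane iff (a) `F(y₀)G'(y₀) > 0` at every real root `y₀` of `G` and (b) for all
sufficiently large `r` the set of roots of `G` in `[−2rπ+ε, 2rπ+ε]` is finite with
exactly `4r + n + 1` elements. -/
theorem quasiPoly_stable_iff (n : ℕ) (hn : 1 ≤ n) (t : Fin n → ℝ) (ht : ∀ i, t i ≠ 0)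
    (h hi hd : ℝ) (ε : ℝ)
    (hε : Real.sin (ε + (n + 1 : ℕ) * Real.pi / 2) ≠ 0)
    (F G : ℝ → ℝ)
    (hF : ∀ y : ℝ, F y = (quasiPoly t h hi hd (Complex.I * (y : ℂ))).re)
    (hG : ∀ y : ℝ, G y = (quasiPoly t h hi hd (Complex.I * (y : ℂ))).im)
    (hnz : ∀ y : ℝ, quasiPoly t h hi hd (Complex.I * (y : ℂ)) ≠ 0) :
    (∀ σ : ℂ, quasiPoly t h hi hd σ = 0 → σ.re < 0) ↔
      ((∀ y₀ : ℝ, G y₀ = 0 → F y₀ * deriv G y₀ > 0) ∧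
        ∃ r₀ : ℕ, ∀ r : ℕ, r₀ ≤ r →
          {y : ℝ | y ∈ Set.Icc (-(2 * r * Real.pi) + ε) (2 * r * Real.pi + ε) ∧
              G y = 0}.Finite ∧
          {y : ℝ | y ∈ Set.Icc (-(2 * r * Real.pi) + ε) (2 * r * Real.pi + ε) ∧
              G y = 0}.ncard = 4 * r + n + 1) := by
  have H := quasiPoly_delayAsymptotics t h hi hd hn ht
  have hsin := sin_ne_zero_of_coeff_ne_zero hn ε hd (∏ i, t i) hε
  have him := phase_im_ne_zero hn ε hd (∏ i, t i) hε
  simp only [mul_comm Complex.I] at hF hG hnz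
  obtain rfl : G = fun y : ℝ => (quasiPoly t h hi hd (y * Complex.I)).im := funext hG
  have hpos : ∀ y : ℝ, (quasiPoly t h hi hd (y * Complex.I)).im = 0 →
      (F y * deriv (fun y : ℝ => (quasiPoly t h hi hd (y * Complex.I)).im) y > 0 ↔
        0 < (deriv (quasiPoly t h hi hd) (y * Complex.I) /
          quasiPoly t h hi hd (y * Complex.I)).re) := by
    intro y hy
    rw [div_re_pos_iff_of_im_eq_zero hy, hF,
      (hasDerivAt_im_comp_mul_I (differentiable_quasiPoly t h hi hd) y).deriv]
  constructor
  · intro hstable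
    have hlog := H.logDeriv_re_pos hsin (quasiPoly_conj t h hi hd)
      (fun σ hσ h0 => (hstable σ h0).not_ge hσ)
    refine ⟨fun y hy => (hpos y hy).2 (hlog y), ?_⟩
    obtain ⟨X₀, r₀, hcount⟩ := H.ncard_im_eq_zero hsin him hnz fun y _ => hlog y
    refine ⟨r₀, fun r hr => ?_⟩
    obtain ⟨N, hN, hfin, hcard⟩ := hcount (max X₀ 0) (le_max_left _ _) r hr
    have hN0 : N = 0 := hN.2 fun z hz h0 => (hstable z h0).not_ge hz.1.1
    refine ⟨hfin, hcard.trans ?_⟩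
    rw [hN0]
    omega
  · rintro ⟨ha, r₁, hb⟩ σ hσ
    by_contra! hre
    obtain ⟨X₀, r₀, hcount⟩ := H.ncard_im_eq_zero hsin him hnz fun y hy => (hpos y hy).1 (ha y hy)
    obtain ⟨r₂, hr₂⟩ := exists_nat_ge (|σ.im| + |ε|)
    set r := max r₀ (max r₁ r₂)
    obtain ⟨N, hN, -, hcard⟩ := hcount (max X₀ σ.re) (le_max_left _ _) r (le_max_left _ _)
    have hr : |σ.im| + |ε| ≤ r := hr₂.trans (by
      exact_mod_cast (le_max_right r₁ r₂).trans (le_max_right _ _))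
    have hbig : |σ.im| + |ε| ≤ 2 * r * Real.pi := by
      nlinarith [Real.pi_gt_three, abs_nonneg σ.im, abs_nonneg ε]
    have hN0 : N = 0 := by
      have := hcard.symm.trans (hb r ((le_max_left r₁ r₂).trans (le_max_right _ _))).2
      omega
    refine hN.1 hN0 σ ⟨⟨hre, le_max_right _ _⟩, ?_⟩ hσ
    have a1 := le_abs_self σ.im
    have a2 := neg_abs_le σ.im
    have a3 := le_abs_self ε
    have a4 := neg_abs_le ε
    constructor <;> linarith
end

section
/- Let t = (t_1,…,t_n) and z = (z_1,…,z_m) be real numbers, and define G₁(y) = −P(y)·cos y + Q(y)·sin y on a neighborhood of 0 (where C(y)²+D(y)² ≠ 0, which holds near 0 since C(0)=1, D(0)=0). Then G₁ is twice differentiable at 0 with G₁(0) = −1, G₁'(0) = 0, and G₁''(0) = 1 + 2e₁(t) + 2e₂(t) − 2e₁(t)e₁(z) + 2e₁(z)² − 2e₁(z) − 2e₂(z). -/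
/-- The `k`-th elementary symmetric polynomial of the reals `t 0, …, t (n-1)`. -/
noncomputable def esymm {n : ℕ} (t : Fin n → ℝ) (k : ℕ) : ℝ :=
  ∑ s ∈ (Finset.univ : Finset (Fin n)).powersetCard k, ∏ i ∈ s, t i

/-- `P(y) = Re[∏ᵢ(1+i tᵢ y)/∏ⱼ(1+i zⱼ y)]`. -/
noncomputable def Pfun {n m : ℕ} (t : Fin n → ℝ) (z : Fin m → ℝ) (y : ℝ) : ℝ :=
  ((∏ i, (1 + Complex.I * (t i : ℂ) * (y : ℂ))) /
    (∏ j, (1 + Complex.I * (z j : ℂ) * (y : ℂ)))).re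

/-- `Q(y) = Im[∏ᵢ(1+i tᵢ y)/∏ⱼ(1+i zⱼ y)]`. -/
noncomputable def Qfun {n m : ℕ} (t : Fin n → ℝ) (z : Fin m → ℝ) (y : ℝ) : ℝ :=
  ((∏ i, (1 + Complex.I * (t i : ℂ) * (y : ℂ))) /
    (∏ j, (1 + Complex.I * (z j : ℂ) * (y : ℂ)))).im

/-- `G₁(y) = −P(y)cos y + Q(y)sin y`. -/
noncomputable def G1 {n m : ℕ} (t : Fin n → ℝ) (z : Fin m → ℝ) (y : ℝ) : ℝ :=
  -Pfun t z y * Real.cos y + Qfun t z y * Real.sin y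

/-- Newton's identity in degree two. -/
theorem Finset.sq_sum_eq_sum_sq_add_powersetCard_two {ι R : Type*} [CommRing R]
    (s : Finset ι) (t : ι → R) :
    (∑ i ∈ s, t i) ^ 2 = ∑ i ∈ s, t i ^ 2 + 2 * ∑ u ∈ s.powersetCard 2, ∏ i ∈ u, t i := by
  classical
  induction s using Finset.induction_on with
  | empty => simp [Finset.powersetCard_eq_empty.2 (show (∅ : Finset ι).card < 2 by simp)]
  | insert a s ha ih =>
    have hdisj : Disjoint (s.powersetCard 2) ((s.powersetCard 1).image (insert a)) := by
      rw [Finset.disjoint_left]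
      intro u hu hu'
      obtain ⟨v, -, rfl⟩ := Finset.mem_image.1 hu'
      exact ha ((Finset.mem_powersetCard.1 hu).1 (Finset.mem_insert_self a v))
    have hinj : Set.InjOn (insert a) (s.powersetCard 1 : Set (Finset ι)) := by
      intro u hu v hv huv
      have hau : a ∉ u := fun h => ha ((Finset.mem_powersetCard.1 hu).1 h)
      have hav : a ∉ v := fun h => ha ((Finset.mem_powersetCard.1 hv).1 h)
      rw [← Finset.erase_insert hau, huv, Finset.erase_insert hav]
    have hsum : ∑ u ∈ s.powersetCard 1, ∏ i ∈ insert a u, t i = t a * ∑ i ∈ s, t i := by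
      rw [Finset.powersetCard_one, Finset.sum_map, Finset.mul_sum]
      refine Finset.sum_congr rfl fun i hi => ?_
      have hai : a ≠ i := fun h => ha (h ▸ hi)
      simp [Finset.prod_pair hai]
    rw [Finset.powersetCard_succ_insert ha, Finset.sum_union hdisj, Finset.sum_image hinj, hsum,
      Finset.sum_insert ha, Finset.sum_insert ha]
    linear_combination ih

theorem esymm_one {n : ℕ} (t : Fin n → ℝ) : esymm t 1 = ∑ i, t i := by
  simp [esymm, Finset.powersetCard_one]

theorem sum_sq_eq_esymm {n : ℕ} (t : Fin n → ℝ) :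
    ∑ i, t i ^ 2 = esymm t 1 ^ 2 - 2 * esymm t 2 := by
  rw [esymm_one, Finset.sq_sum_eq_sum_sq_add_powersetCard_two, esymm]
  ring

theorem one_add_I_mul_ofReal_ne_zero (a y : ℝ) : (1 + Complex.I * (a : ℂ) * (y : ℂ)) ≠ 0 := by
  intro h
  simpa using congrArg Complex.re h

theorem hasDerivAt_one_add_I_mul (a y : ℝ) :
    HasDerivAt (fun y : ℝ => 1 + Complex.I * (a : ℂ) * (y : ℂ)) (Complex.I * a) y := by
  simpa using ((Complex.ofRealCLM.hasDerivAt (x := y)).const_mul (Complex.I * (a : ℂ))).const_add 1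

/-- The logarithmic derivative of `∏ᵢ(1+i tᵢ y)`. -/
noncomputable def logDerivProd {n : ℕ} (t : Fin n → ℝ) (y : ℝ) : ℂ :=
  ∑ i, Complex.I * (t i : ℂ) / (1 + Complex.I * (t i : ℂ) * (y : ℂ))

theorem hasDerivAt_prod_one_add_I_mul {n : ℕ} (t : Fin n → ℝ) (y : ℝ) :
    HasDerivAt (fun y : ℝ => ∏ i, (1 + Complex.I * (t i : ℂ) * (y : ℂ)))
      ((∏ i, (1 + Complex.I * (t i : ℂ) * (y : ℂ))) * logDerivProd t y) y := by
  refine (HasDerivAt.fun_finsetProd (u := Finset.univ)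
    fun i _ => hasDerivAt_one_add_I_mul (t i) y).congr_deriv ?_
  rw [logDerivProd, Finset.mul_sum]
  refine Finset.sum_congr rfl fun i hi => ?_
  have h := one_add_I_mul_ofReal_ne_zero (t i) y
  rw [← Finset.mul_prod_erase _ _ hi, smul_eq_mul, mul_right_comm, mul_div_cancel₀ _ h, mul_comm]

theorem logDerivProd_zero {n : ℕ} (t : Fin n → ℝ) :
    logDerivProd t 0 = Complex.I * (esymm t 1 : ℝ) := by
  simp [logDerivProd, esymm_one, Finset.mul_sum]

theorem hasDerivAt_logDerivProd_zero {n : ℕ} (t : Fin n → ℝ) :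
    HasDerivAt (logDerivProd t) ((esymm t 1 ^ 2 - 2 * esymm t 2 : ℝ) : ℂ) 0 := by
  have h := HasDerivAt.fun_sum (u := Finset.univ) fun i _ =>
    (hasDerivAt_const (0 : ℝ) (Complex.I * (t i : ℂ))).fun_div (hasDerivAt_one_add_I_mul (t i) 0)
      (one_add_I_mul_ofReal_ne_zero (t i) 0)
  refine h.congr_deriv ?_
  rw [← sum_sq_eq_esymm]
  push_cast
  refine Finset.sum_congr rfl fun i _ => ?_
  simp
  linear_combination (-(t i : ℂ) ^ 2) * Complex.I_sq

/-- `∏ᵢ(1+i tᵢ y)/∏ⱼ(1+i zⱼ y) · exp(iy)`. -/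
noncomputable def prodDivProdMulExp {n m : ℕ} (t : Fin n → ℝ) (z : Fin m → ℝ) (y : ℝ) : ℂ :=
  (∏ i, (1 + Complex.I * (t i : ℂ) * (y : ℂ))) /
    (∏ j, (1 + Complex.I * (z j : ℂ) * (y : ℂ))) * Complex.exp (y * Complex.I)

theorem G1_eq_neg_re {n m : ℕ} (t : Fin n → ℝ) (z : Fin m → ℝ) :
    G1 t z = fun y => -(prodDivProdMulExp t z y).re := by
  funext y
  rw [G1, Pfun, Qfun, prodDivProdMulExp, Complex.mul_re, Complex.exp_ofReal_mul_I_re,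
    Complex.exp_ofReal_mul_I_im]
  ring

theorem hasDerivAt_prodDivProdMulExp {n m : ℕ} (t : Fin n → ℝ) (z : Fin m → ℝ) (y : ℝ) :
    HasDerivAt (prodDivProdMulExp t z)
      (prodDivProdMulExp t z y * (Complex.I + logDerivProd t y - logDerivProd z y)) y := by
  have hz : (∏ j, (1 + Complex.I * (z j : ℂ) * (y : ℂ))) ≠ 0 :=
    Finset.prod_ne_zero_iff.2 fun j _ => one_add_I_mul_ofReal_ne_zero (z j) y
  have hexp : HasDerivAt (fun y : ℝ => Complex.exp (y * Complex.I))
      (Complex.exp (y * Complex.I) * Complex.I) y := by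
    simpa using ((Complex.ofRealCLM.hasDerivAt (x := y)).mul_const Complex.I).cexp
  refine (((hasDerivAt_prod_one_add_I_mul t y).fun_div (hasDerivAt_prod_one_add_I_mul z y) hz).fun_mul
    hexp).congr_deriv ?_
  rw [prodDivProdMulExp]
  generalize (∏ j, (1 + Complex.I * (z j : ℂ) * (y : ℂ))) = w at hz ⊢
  generalize (∏ i, (1 + Complex.I * (t i : ℂ) * (y : ℂ))) = v
  field_simp
  ring

theorem HasDerivAt.neg_complex_re {f : ℝ → ℂ} {f' : ℂ} {y : ℝ} (h : HasDerivAt f f' y) :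
    HasDerivAt (fun y => -(f y).re) (-f'.re) y :=
  (Complex.reCLM.hasFDerivAt.comp_hasDerivAt y h).neg

/-- `G₁` is twice differentiable at `0` with `G₁(0) = −1`, `G₁'(0) = 0`
and `G₁''(0) = Φ₂` (the paper's eq. (2.17)). -/
theorem G1_value_deriv_deriv2_at_zero (n m : ℕ) (t : Fin n → ℝ) (z : Fin m → ℝ) :
    G1 t z 0 = -1 ∧
    DifferentiableAt ℝ (G1 t z) 0 ∧
    deriv (G1 t z) 0 = 0 ∧
    DifferentiableAt ℝ (deriv (G1 t z)) 0 ∧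
    deriv (deriv (G1 t z)) 0 =
      1 + 2 * esymm t 1 + 2 * esymm t 2 - 2 * esymm t 1 * esymm z 1 +
        2 * esymm z 1 ^ 2 - 2 * esymm z 1 - 2 * esymm z 2 := by
  have hH := hasDerivAt_prodDivProdMulExp t z
  have hH0 : prodDivProdMulExp t z 0 = 1 := by simp [prodDivProdMulExp]
  have hG : ∀ y, HasDerivAt (G1 t z) (-(prodDivProdMulExp t z y *
      (Complex.I + logDerivProd t y - logDerivProd z y)).re) y := by
    rw [G1_eq_neg_re]
    exact fun y => (hH y).neg_complex_re
  have hG2 := ((hH 0).fun_mul (((hasDerivAt_logDerivProd_zero t).const_add Complex.I).fun_sub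
    (hasDerivAt_logDerivProd_zero z))).neg_complex_re
  rw [← funext fun y => (hG y).deriv] at hG2
  refine ⟨by simp [G1_eq_neg_re, hH0], (hG 0).differentiableAt, ?_, hG2.differentiableAt, ?_⟩
  · rw [(hG 0).deriv, hH0, logDerivProd_zero, logDerivProd_zero]
    simp
  · rw [hG2.deriv, hH0, logDerivProd_zero, logDerivProd_zero]
    simp [-Complex.ofReal_sub, -Complex.ofReal_mul, -Complex.ofReal_pow]
    ring
end

section
/- Let u₁, u₂, v₁, v₂ be real numbers with D := u₁² − 2u₂ − v₁² + 2v₂ ≥ 0, and set e₋ = ((−u₁+v₁) − √D)/2, e₊ = ((−u₁+v₁) + √D)/2, Φ₁ = 1 + u₁ − v₁, and Φ₂ = 1 + 2u₁ + 2u₂ − 2u₁v₁ + 2v₁² − 2v₁ − 2v₂. Then (2e₊ − 1)(2e₋ − 1) = Φ₂, and: (i) if Φ₁ > 0 and Φ₂ > 0 then e₋ < 1/2 and e₊ < 1/2; (ii) if Φ₂ < 0 then e₋ < 1/2 < e₊; (iii) if Φ₁ < 0 and Φ₂ > 0 then e₋ > 1/2 and e₊ > 1/2. -/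
/-- paper's classification after eqs. (2.15)–(2.17). The branch
derivatives `e₋, e₊` of `E(y)` at `0` compare to `1/2` (the derivative of `tan(y/2)`)
according to the signs of `Φ₁` and `Φ₂`. -/
theorem branch_derivatives_vs_half (u₁ u₂ v₁ v₂ : ℝ)
    (hD : u₁ ^ 2 - 2 * u₂ - v₁ ^ 2 + 2 * v₂ ≥ 0) :
    let D := u₁ ^ 2 - 2 * u₂ - v₁ ^ 2 + 2 * v₂
    let eminus := ((-u₁ + v₁) - Real.sqrt D) / 2
    let eplus := ((-u₁ + v₁) + Real.sqrt D) / 2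
    let Φ₁ := 1 + u₁ - v₁
    let Φ₂ := 1 + 2 * u₁ + 2 * u₂ - 2 * u₁ * v₁ + 2 * v₁ ^ 2 - 2 * v₁ - 2 * v₂
    (2 * eplus - 1) * (2 * eminus - 1) = Φ₂ ∧
    (Φ₁ > 0 → Φ₂ > 0 → eminus < 1 / 2 ∧ eplus < 1 / 2) ∧
    (Φ₂ < 0 → eminus < 1 / 2 ∧ 1 / 2 < eplus) ∧
    (Φ₁ < 0 → Φ₂ > 0 → eminus > 1 / 2 ∧ eplus > 1 / 2) := by
  intro D eminus eplus Φ₁ Φ₂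
  have hs : 0 ≤ √D := Real.sqrt_nonneg D
  have hsq : √D ^ 2 = D := Real.sq_sqrt hD
  have hΦ : Φ₂ = Φ₁ ^ 2 - √D ^ 2 := by
    rw [hsq]
    simp only [Φ₁, Φ₂, D]
    ring
  have hminus : 2 * eminus - 1 = -Φ₁ - √D := by
    simp only [eminus, Φ₁]
    ring
  have hplus : 2 * eplus - 1 = -Φ₁ + √D := by
    simp only [eplus, Φ₁]
    ring
  clear_value D eminus eplus Φ₁ Φ₂
  refine ⟨by rw [hminus, hplus, hΦ]; ring, fun h₁ h₂ => ?_, fun h₂ => ?_, fun h₁ h₂ => ?_⟩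
  · have : √D < Φ₁ := lt_of_pow_lt_pow_left₀ 2 h₁.le (by linarith)
    constructor <;> linarith
  · obtain ⟨hl, hr⟩ := abs_lt_of_sq_lt_sq' (show Φ₁ ^ 2 < √D ^ 2 by linarith) hs
    constructor <;> linarith
  · have : √D < -Φ₁ := lt_of_pow_lt_pow_left₀ 2 (by linarith) (by rw [neg_sq]; linarith)
    constructor <;> linarith
end
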